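/- Let N ≥ 8 be an integer divisible by 4. The N/2 − 1 linear functionals b ↦ ψ^{(i,j,k,l)}(b) on ℝ^{N/2}, indexed by (i,j,k,l) ∈ S_1 ∪ S_2, are linearly independent; equivalently, the solution set {b ∈ ℝ^{N/2} : ψ^{(i,j,k,l)}(b) = 0 for all (i,j,k,l) ∈ S_1 ∪ S_2} is a one-dimensional linear subspace of ℝ^{N/2}, so in particular a nontrivial solution b ≠ 0 exists. -/

import Mathlib

/-- `c_α = cos(απ/N)` -/
noncomputable def cc (N : ℕ) (a : ℤ) : ℝ := Real.cos (a * Real.pi / N)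

/-- `s_α = sin(απ/N)` -/
noncomputable def ss (N : ℕ) (a : ℤ) : ℝ := Real.sin (a * Real.pi / N)

/-- `f_q^{(i,j,k,l)}` -/
noncomputable def ff (N : ℕ) (i j k l : ℤ) (q : ℕ) : ℝ :=
  if Odd q then cc N (i * q) * cc N (j * q) * cc N (k * q) * cc N (l * q)
  else ss N (i * q) * ss N (j * q) * ss N (k * q) * ss N (l * q)

/-- `ψ^{(i,j,k,l)}(b)` -/
noncomputable def psi (N : ℕ) (b : Fin (N / 2) → ℝ) (i j k l : ℤ) : ℝ :=
  -∑ q : Fin (N / 2), (-1 : ℝ) ^ ((q : ℕ) + 1) * b q * ff N i j k l ((q : ℕ) + 1)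

/-- `b ↦ ψ^{(i,j,k,l)}(b)` as a linear functional on `ℝ^{N/2}`. -/
noncomputable def psiLin (N : ℕ) (i j k l : ℤ) : (Fin (N / 2) → ℝ) →ₗ[ℝ] ℝ :=
  ∑ q : Fin (N / 2),
    (-((-1 : ℝ) ^ ((q : ℕ) + 1) * ff N i j k l ((q : ℕ) + 1))) • LinearMap.proj q

/-- `S₁ = {(0, n+1, N/2−n, N/2−1) : 1 ≤ n ≤ N/4−1}` -/
def S1set (N : ℕ) : Set (ℤ × ℤ × ℤ × ℤ) :=
  {x | ∃ n : ℤ, 1 ≤ n ∧ n ≤ (N : ℤ) / 4 - 1 ∧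
    x = (0, n + 1, (N : ℤ) / 2 - n, (N : ℤ) / 2 - 1)}

/-- `S₂ = {(2−m, m, N/2−1, N/2−1) : m = 1 or 3 ≤ m ≤ N/4+1}` -/
def S2set (N : ℕ) : Set (ℤ × ℤ × ℤ × ℤ) :=
  {x | ∃ m : ℤ, (m = 1 ∨ (3 ≤ m ∧ m ≤ (N : ℤ) / 4 + 1)) ∧
    x = (2 - m, m, (N : ℤ) / 2 - 1, (N : ℤ) / 2 - 1)}

theorem eight_mul_cos_mul_cos_mul_cos_mul_cos_add (x y z : ℝ) :
    8 * (Real.cos x * Real.cos y * Real.cos z * Real.cos (x + y + z)) =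
      1 + Real.cos (2 * (x + y)) + Real.cos (2 * (x + z)) + Real.cos (2 * (y + z)) +
        (Real.cos (2 * x) + Real.cos (2 * y) + Real.cos (2 * z) + Real.cos (2 * (x + y + z))) := by
  have h1 := Real.two_mul_cos_mul_cos x y
  have h2 := Real.two_mul_cos_mul_cos z (x + y + z)
  have h3 := Real.two_mul_cos_mul_cos (x - y) (z - (x + y + z))
  have h4 := Real.two_mul_cos_mul_cos (x - y) (z + (x + y + z))
  have h5 := Real.two_mul_cos_mul_cos (x + y) (z - (x + y + z))
  have h6 := Real.two_mul_cos_mul_cos (x + y) (z + (x + y + z))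
  rw [show x - y - (z - (x + y + z)) = 2 * x by ring,
    show x - y + (z - (x + y + z)) = -(2 * y) by ring, Real.cos_neg] at h3
  rw [show x - y - (z + (x + y + z)) = -(2 * (y + z)) by ring, Real.cos_neg,
    show x - y + (z + (x + y + z)) = 2 * (x + z) by ring] at h4
  rw [show x + y - (z - (x + y + z)) = 2 * (x + y) by ring,
    show x + y + (z - (x + y + z)) = 0 by ring, Real.cos_zero] at h5
  rw [show x + y - (z + (x + y + z)) = -(2 * z) by ring, Real.cos_neg,
    show x + y + (z + (x + y + z)) = 2 * (x + y + z) by ring] at h6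
  linear_combination 4 * Real.cos z * Real.cos (x + y + z) * h1 +
    2 * (Real.cos (x - y) + Real.cos (x + y)) * h2 + h3 + h4 + h5 + h6

theorem eight_mul_sin_mul_sin_mul_sin_mul_sin_add (x y z : ℝ) :
    8 * (Real.sin x * Real.sin y * Real.sin z * Real.sin (x + y + z)) =
      Real.cos (2 * x) + Real.cos (2 * y) + Real.cos (2 * z) + Real.cos (2 * (x + y + z)) -
        (1 + Real.cos (2 * (x + y)) + Real.cos (2 * (x + z)) + Real.cos (2 * (y + z))) := by
  have h1 := Real.two_mul_sin_mul_sin x y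
  have h2 := Real.two_mul_sin_mul_sin z (x + y + z)
  have h3 := Real.two_mul_cos_mul_cos (x - y) (z - (x + y + z))
  have h4 := Real.two_mul_cos_mul_cos (x - y) (z + (x + y + z))
  have h5 := Real.two_mul_cos_mul_cos (x + y) (z - (x + y + z))
  have h6 := Real.two_mul_cos_mul_cos (x + y) (z + (x + y + z))
  rw [show x - y - (z - (x + y + z)) = 2 * x by ring,
    show x - y + (z - (x + y + z)) = -(2 * y) by ring, Real.cos_neg] at h3
  rw [show x - y - (z + (x + y + z)) = -(2 * (y + z)) by ring, Real.cos_neg,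
    show x - y + (z + (x + y + z)) = 2 * (x + z) by ring] at h4
  rw [show x + y - (z - (x + y + z)) = 2 * (x + y) by ring,
    show x + y + (z - (x + y + z)) = 0 by ring, Real.cos_zero] at h5
  rw [show x + y - (z + (x + y + z)) = -(2 * z) by ring, Real.cos_neg,
    show x + y + (z + (x + y + z)) = 2 * (x + y + z) by ring] at h6
  linear_combination 4 * Real.sin z * Real.sin (x + y + z) * h1 +
    2 * (Real.cos (x - y) - Real.cos (x + y)) * h2 + h3 - h4 - h5 + h6

/-- The combination of the values of `g` that expresses `8 (-1)^q f_q^{(i,j,k,l)}` when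
`i + j + k + l = 2M` and `g a = cos (a q π / M)`. -/
def quadComb {E : Type*} [AddCommGroup E] (M : ℤ) (g : ℤ → E) (x : ℤ × ℤ × ℤ × ℤ) : E :=
  g 0 + g (x.1 + x.2.1) + g (x.1 + x.2.2.1) + g (x.1 + x.2.2.2) -
    (g (M - x.1) + g (M - x.2.1) + g (M - x.2.2.1) + g (M - x.2.2.2))

theorem map_quadComb {E F : Type*} [AddCommGroup E] [AddCommGroup F] [Module ℝ E] [Module ℝ F]
    (L : E →ₗ[ℝ] F) (M : ℤ) (g : ℤ → E) (x : ℤ × ℤ × ℤ × ℤ) :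
    L (quadComb M g x) = quadComb M (fun a => L (g a)) x := by
  simp [quadComb]

/-- The vector of values `cos (a q π / M)` for `0 ≤ q ≤ M`. -/
noncomputable def cosVec (M : ℕ) (a : ℤ) : Fin (M + 1) → ℝ :=
  fun q => Real.cos (a * ((q : ℕ) * Real.pi / M))

/-- Reflection of an index in `[0, 2M]` into `[0, M]`. -/
def reflectIdx (M : ℕ) (a : ℤ) : ℕ := if a ≤ M then a.toNat else (2 * M - a).toNat

theorem cosVec_reflectIdx (M : ℕ) (hM : 0 < M) (a : ℤ) (ha0 : 0 ≤ a) (ha : a ≤ 2 * M) :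
    cosVec M (reflectIdx M a) = cosVec M a := by
  have hM' : (M : ℝ) ≠ 0 := by positivity
  unfold reflectIdx
  split_ifs with h
  · rw [Int.toNat_of_nonneg ha0]
  · rw [Int.toNat_of_nonneg (by omega)]
    ext q
    unfold cosVec
    rw [show (((2 * (M : ℤ) - a : ℤ) : ℝ)) * ((q : ℕ) * Real.pi / M) =
      ((q : ℕ) : ℝ) * (2 * Real.pi) - a * ((q : ℕ) * Real.pi / M) by push_cast; field_simp,
      Real.cos_nat_mul_two_pi_sub]

theorem linearIndependent_cosVec (M : ℕ) (hM : 0 < M) :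
    LinearIndependent ℝ (fun a : Fin (M + 1) => cosVec M ((a : ℕ) : ℤ)) := by
  have hM' : (0 : ℝ) < M := by positivity
  rw [Fintype.linearIndependent_iff]
  intro p hp
  have hinj : Function.Injective
      (fun q : Fin (M + 1) => Real.cos ((q : ℕ) * Real.pi / M)) := by
    have hmem : ∀ q : Fin (M + 1), ((q : ℕ) * Real.pi / M) ∈ Set.Icc 0 Real.pi := by
      intro q
      refine ⟨by positivity, ?_⟩
      rw [div_le_iff₀ hM', mul_comm]
      gcongr
      exact_mod_cast Nat.lt_succ_iff.mp q.2
    intro q r h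
    have := Real.injOn_cos (hmem q) (hmem r) h
    field_simp at this
    exact Fin.ext (by exact_mod_cast this)
  have hzero : ∑ a : Fin (M + 1), p a • Polynomial.Chebyshev.T ℝ ((a : ℕ) : ℤ) = 0 := by
    refine Polynomial.eq_zero_of_natDegree_lt_card_of_eval_eq_zero _ hinj ?_ ?_
    · intro q
      have := congrFun hp q
      simpa [Polynomial.eval_finsetSum, Polynomial.Chebyshev.T_real_cos, cosVec] using this
    · rw [Fintype.card_fin, Nat.lt_succ_iff]
      refine Polynomial.natDegree_sum_le_of_forall_le _ _ fun a _ => ?_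
      refine (Polynomial.natDegree_smul_le _ _).trans ?_
      rw [Polynomial.Chebyshev.natDegree_T]
      have := a.2
      simp
      omega
  have hT : LinearIndependent ℝ
      (fun a : Fin (M + 1) => Polynomial.Chebyshev.T ℝ ((a : ℕ) : ℤ)) :=
    (Polynomial.Chebyshev.chebyshevTsequence ℝ).linearIndependent.comp (fun a : Fin (M + 1) => (a : ℕ))
      Fin.val_injective
  exact Fintype.linearIndependent_iff.mp hT p hzero

theorem exists_linearMap_cosVec (M : ℕ) (hM : 0 < M) (h : ℕ → ℝ) :
    ∃ L : (Fin (M + 1) → ℝ) →ₗ[ℝ] ℝ, ∀ a : ℕ, a ≤ M → L (cosVec M a) = h a := by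
  have hli := linearIndependent_cosVec M hM
  let B := basisOfLinearIndependentOfCardEqFinrank hli (by simp)
  refine ⟨B.constr ℝ fun a => h a, fun a ha => ?_⟩
  have := B.constr_basis ℝ (fun a => h a) ⟨a, Nat.lt_succ_iff.mpr ha⟩
  simpa [B] using this

theorem ff_eq_quadComb (M : ℕ) (hM : 0 < M) (i j k l : ℤ) (h : i + j + k + l = 2 * M) (q : ℕ) :
    8 * ((-1 : ℝ) ^ q * ff (2 * M) i j k l q) =
      quadComb M (fun a => Real.cos (a * (q * Real.pi / M))) (i, j, k, l) := by
  have hM' : (M : ℝ) ≠ 0 := by positivity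
  obtain rfl : l = 2 * M - (i + j + k) := by omega
  set t : ℝ := q * Real.pi / (2 * M) with ht
  have hq : (q : ℝ) * Real.pi / M = 2 * t := by rw [ht]; field_simp
  have hpi : (M : ℝ) * (2 * t) = q * Real.pi := by rw [ht]; field_simp
  have harg : ∀ a : ℤ, ((a * (q : ℤ) : ℤ) : ℝ) * Real.pi / ((2 * M : ℕ) : ℝ) = a * t := by
    intro a; rw [ht]; push_cast; ring
  have hl : (((2 * (M : ℤ) - (i + j + k) : ℤ) : ℝ)) * t = q * Real.pi - (i * t + j * t + k * t) := by
    push_cast; linear_combination hpi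
  have hrefl : ∀ a : ℤ, Real.cos (((M : ℤ) - a : ℤ) * (2 * t)) =
      (-1) ^ q * Real.cos (2 * (a * t)) := by
    intro a
    rw [← Real.cos_nat_mul_pi_sub]
    congr 1
    push_cast
    linear_combination hpi
  have h4 : Real.cos (2 * ((2 * (M : ℤ) - (i + j + k) : ℤ) * t)) =
      Real.cos (2 * (i * t + j * t + k * t)) := by
    rw [hl, ← Real.cos_nat_mul_two_pi_sub _ q]
    congr 1
    ring
  have h14 : Real.cos ((i + (2 * (M : ℤ) - (i + j + k)) : ℤ) * (2 * t)) =
      Real.cos (2 * (j * t + k * t)) := by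
    rw [← Real.cos_nat_mul_two_pi_sub _ q]
    congr 1
    push_cast
    linear_combination -2 * hpi
  have h12 : ∀ a b : ℤ, Real.cos ((a + b : ℤ) * (2 * t)) = Real.cos (2 * (a * t + b * t)) := by
    intro a b; congr 1; push_cast; ring
  simp only [quadComb, hq]
  rw [hrefl, hrefl, hrefl, hrefl, h14, h12, h12, h4]
  simp only [ff, cc, ss, harg, hl, Int.cast_zero, zero_mul, Real.cos_zero]
  rw [Real.cos_nat_mul_pi_sub, Real.sin_nat_mul_pi_sub]
  have hc := eight_mul_cos_mul_cos_mul_cos_mul_cos_add (i * t) (j * t) (k * t)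
  have hs := eight_mul_sin_mul_sin_mul_sin_mul_sin_add (i * t) (j * t) (k * t)
  split_ifs with hodd
  · rw [hodd.neg_one_pow]
    linear_combination hc
  · rw [(Nat.not_odd_iff_even.mp hodd).neg_one_pow]
    linear_combination -hs

theorem psiLin_single (N : ℕ) (i j k l : ℤ) (q : Fin (N / 2)) :
    psiLin N i j k l (Pi.single q 1) =
      -((-1 : ℝ) ^ ((q : ℕ) + 1) * ff N i j k l ((q : ℕ) + 1)) := by
  simp [psiLin, Pi.single_apply]

theorem psiLin_apply (N : ℕ) (b : Fin (N / 2) → ℝ) (i j k l : ℤ) :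
    psiLin N i j k l b = psi N b i j k l := by
  simp only [psiLin, psi, LinearMap.sum_apply, LinearMap.smul_apply, LinearMap.proj_apply,
    smul_eq_mul, ← Finset.sum_neg_distrib]
  exact Finset.sum_congr rfl fun q _ => by ring

/-- The quadruples with entry sum `2M` for which all indices in `quadComb` lie in `[0, 2M]`. -/
def Admissible (M : ℕ) (x : ℤ × ℤ × ℤ × ℤ) : Prop :=
  x.1 + x.2.1 + x.2.2.1 + x.2.2.2 = 2 * M ∧
  (0 ≤ x.1 + x.2.1 ∧ x.1 + x.2.1 ≤ 2 * M) ∧ (0 ≤ x.1 + x.2.2.1 ∧ x.1 + x.2.2.1 ≤ 2 * M) ∧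
  (0 ≤ x.1 + x.2.2.2 ∧ x.1 + x.2.2.2 ≤ 2 * M) ∧ (-M ≤ x.1 ∧ x.1 ≤ M) ∧
  (-M ≤ x.2.1 ∧ x.2.1 ≤ M) ∧ (-M ≤ x.2.2.1 ∧ x.2.2.1 ≤ M) ∧ (-M ≤ x.2.2.2 ∧ x.2.2.2 ≤ M)

theorem quadComb_congr {E : Type*} [AddCommGroup E] {M : ℕ} {f g : ℤ → E}
    (hfg : ∀ a : ℤ, 0 ≤ a → a ≤ 2 * M → f a = g a) {x : ℤ × ℤ × ℤ × ℤ} (hx : Admissible M x) :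
    quadComb M f x = quadComb M g x := by
  obtain ⟨-, h2, h3, h4, h5, h6, h7, h8⟩ := hx
  unfold quadComb
  rw [hfg 0 (by omega) (by omega), hfg _ h2.1 h2.2, hfg _ h3.1 h3.2, hfg _ h4.1 h4.2,
    hfg (M - x.1) (by omega) (by omega), hfg (M - x.2.1) (by omega) (by omega),
    hfg (M - x.2.2.1) (by omega) (by omega), hfg (M - x.2.2.2) (by omega) (by omega)]

theorem sum_mul_quadComb_eq_zero {ι : Type*} (M : ℕ) (hM : 0 < M) (s : Finset ι) (w : ι → ℝ)
    (x : ι → ℤ × ℤ × ℤ × ℤ) (hx : ∀ t ∈ s, Admissible M (x t))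
    (hw : ∑ t ∈ s, w t • psiLin (2 * M) (x t).1 (x t).2.1 (x t).2.2.1 (x t).2.2.2 = 0)
    (g : ℤ → ℤ) (hg : ∀ a, g (2 * M - a) = g a) :
    ∑ t ∈ s, w t * ((quadComb M g (x t) : ℤ) : ℝ) = 0 := by
  have hvec : ∑ t ∈ s, w t • quadComb M (cosVec M) (x t) = 0 := by
    ext q
    rw [Finset.sum_apply, Pi.zero_apply]
    have hq : ∀ t, (w t • quadComb M (cosVec M) (x t)) q =
        w t * quadComb M (fun a => Real.cos (a * ((q : ℕ) * Real.pi / M))) (x t) := by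
      intro t; simp [quadComb, cosVec]
    simp only [hq]
    obtain ⟨q, hqM⟩ := q
    rcases q with _ | q
    · exact Finset.sum_eq_zero fun t _ => by simp [quadComb]
    · have := LinearMap.congr_fun hw (Pi.single ⟨q, by omega⟩ 1)
      simp only [LinearMap.sum_apply, LinearMap.smul_apply, psiLin_single, smul_eq_mul,
        LinearMap.zero_apply] at this
      rw [← mul_zero (-8 : ℝ), ← this, Finset.mul_sum]
      refine Finset.sum_congr rfl fun t ht => ?_
      have := ff_eq_quadComb M hM _ _ _ _ (hx t ht).1 (q + 1)
      linear_combination -(w t) * this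
  obtain ⟨L, hL⟩ := exists_linearMap_cosVec M hM fun a => g a
  have hLg : ∀ a : ℤ, 0 ≤ a → a ≤ 2 * M → L (cosVec M a) = g a := by
    intro a h0 h1
    have hle : reflectIdx M a ≤ M := by unfold reflectIdx; split_ifs <;> omega
    rw [← cosVec_reflectIdx M hM a h0 h1, hL _ hle]
    unfold reflectIdx
    split_ifs
    · rw [Int.toNat_of_nonneg h0]
    · rw [Int.toNat_of_nonneg (by omega), hg]
  have := congrArg L hvec
  rw [map_sum, map_zero] at this
  rw [← this]
  refine Finset.sum_congr rfl fun t ht => ?_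
  rw [map_smul, map_quadComb, quadComb_congr hLg (hx t ht), smul_eq_mul]
  simp [quadComb]

theorem mem_S1set_four_mul {K : ℕ} {x : ℤ × ℤ × ℤ × ℤ} :
    x ∈ S1set (4 * K) ↔
      ∃ n : ℤ, 1 ≤ n ∧ n ≤ K - 1 ∧ x = (0, n + 1, 2 * (K : ℤ) - n, 2 * (K : ℤ) - 1) := by
  have h4 : ((4 * K : ℕ) : ℤ) / 4 = K := by omega
  have h2 : ((4 * K : ℕ) : ℤ) / 2 = 2 * K := by omega
  simp only [S1set, h4, h2, Set.mem_ofPred_eq]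

theorem mem_S2set_four_mul {K : ℕ} {x : ℤ × ℤ × ℤ × ℤ} :
    x ∈ S2set (4 * K) ↔ ∃ m : ℤ, (m = 1 ∨ (3 ≤ m ∧ m ≤ K + 1)) ∧
      x = (2 - m, m, 2 * (K : ℤ) - 1, 2 * (K : ℤ) - 1) := by
  have h4 : ((4 * K : ℕ) : ℤ) / 4 = K := by omega
  have h2 : ((4 * K : ℕ) : ℤ) / 2 = 2 * K := by omega
  simp only [S2set, h4, h2, Set.mem_ofPred_eq]

theorem admissible_of_mem {K : ℕ} (hK : 2 ≤ K) {x : ℤ × ℤ × ℤ × ℤ}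
    (hx : x ∈ S1set (4 * K) ∪ S2set (4 * K)) : Admissible (2 * K) x := by
  rcases hx with hx | hx
  · obtain ⟨n, h1, h2, rfl⟩ := mem_S1set_four_mul.mp hx
    simp only [Admissible]
    omega
  · obtain ⟨m, hm, rfl⟩ := mem_S2set_four_mul.mp hx
    simp only [Admissible]
    omega

/-- `quadComb (2K)` applied to the extension of `f` from `[0, 2K]` to `[0, 4K]` by reflection. -/
def foldComb (K : ℕ) (f : ℤ → ℤ) (x : ℤ × ℤ × ℤ × ℤ) : ℤ :=
  quadComb (2 * K) (fun a => f (min a (2 * (2 * K) - a))) x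

theorem foldComb_S1 {K : ℕ} (f : ℤ → ℤ) {n : ℤ} (h1 : 1 ≤ n) (h2 : n ≤ K - 1) :
    foldComb K f (0, n + 1, 2 * (K : ℤ) - n, 2 * (K : ℤ) - 1) =
      f 0 + f (n + 1) + f (2 * K - n) + f (2 * K - 1) -
        (f (2 * K) + f (2 * K - n - 1) + f n + f 1) := by
  simp (disch := omega) only [foldComb, quadComb, min_eq_left]
  ring_nf

theorem foldComb_S2_one {K : ℕ} (hK : 2 ≤ K) (f : ℤ → ℤ) :
    foldComb K f (1, 1, 2 * (K : ℤ) - 1, 2 * (K : ℤ) - 1) =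
      f 0 + f 2 + 2 * f (2 * K) - (2 * f (2 * K - 1) + 2 * f 1) := by
  simp (disch := omega) only [foldComb, quadComb, min_eq_left]
  ring_nf

theorem foldComb_S2 {K : ℕ} (f : ℤ → ℤ) {m : ℤ} (h3 : 3 ≤ m) (hm : m ≤ K + 1) :
    foldComb K f (2 - m, m, 2 * (K : ℤ) - 1, 2 * (K : ℤ) - 1) =
      f 0 + f 2 + 2 * f (2 * K + 1 - m) -
        (f (2 * K + 2 - m) + f (2 * K - m) + 2 * f 1) := by
  simp only [foldComb, quadComb]
  rw [min_eq_right (a := 2 * (K : ℤ) - (2 - m)) (by omega)]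
  simp (disch := omega) only [min_eq_left]
  ring_nf

theorem linearIndependent_psiLin {K : ℕ} (hK : 2 ≤ K) :
    LinearIndependent ℝ (fun x : ↥(S1set (4 * K) ∪ S2set (4 * K)) =>
      psiLin (4 * K) x.1.1 x.1.2.1 x.1.2.2.1 x.1.2.2.2) := by
  rw [linearIndependent_iff']
  intro s w hw
  have hN : 4 * K = 2 * (2 * K) := by ring
  have hadm : ∀ t ∈ s, Admissible (2 * K) t.1 := fun t _ => admissible_of_mem hK t.2
  have hisolate : ∀ f : ℤ → ℤ, ∀ x ∈ s,
      foldComb K f x.1 ≠ 0 →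
      (∀ y ∈ s, y ≠ x → w y = 0 ∨ foldComb K f y.1 = 0) → w x = 0 := by
    intro f x hx hne hother
    have := sum_mul_quadComb_eq_zero (2 * K) (by omega) s w (fun t => t.1) hadm
      (by rw [← hN]; exact hw) (fun a => f (min a (2 * (2 * K) - a)))
      (by intro a; push_cast; rw [sub_sub_cancel, min_comm])
    push_cast at this
    change ∑ t ∈ s, w t * ((foldComb K f t.1 : ℤ) : ℝ) = 0 at this
    rw [Finset.sum_eq_single_of_mem x hx] at this
    · exact (mul_eq_zero.mp this).resolve_right (by exact_mod_cast hne)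
    · intro y hy hyx
      rcases hother y hy hyx with h | h <;> simp [h]
  have hone : ∀ x ∈ s, x.1 = (1, 1, 2 * (K : ℤ) - 1, 2 * (K : ℤ) - 1) → w x = 0 := by
    intro x hx hx1
    refine hisolate (fun a => a * (2 * K - a)) x hx ?_ ?_
    · rw [hx1, foldComb_S2_one hK]
      ring_nf
      omega
    · rintro ⟨y, hyS⟩ hy hyx
      right
      rcases (Set.mem_union _ _ _).mp hyS with hyS' | hyS'
      · obtain ⟨n, h1, h2, rfl⟩ := mem_S1set_four_mul.mp hyS'
        rw [foldComb_S1 _ h1 h2]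
        ring
      · obtain ⟨m, rfl | hm, rfl⟩ := mem_S2set_four_mul.mp hyS'
        · exact absurd (Subtype.ext (by rw [hx1]; norm_num)) hyx
        · rw [foldComb_S2 _ hm.1 hm.2]
          ring
  have htwo : ∀ x ∈ s, ∀ m : ℤ, 3 ≤ m → m ≤ K + 1 →
      x.1 = (2 - m, m, 2 * (K : ℤ) - 1, 2 * (K : ℤ) - 1) → w x = 0 := by
    intro x hx m hm3 hmK hxm
    refine hisolate (fun a => min (min a (2 * K - a)) (m - 1)) x hx ?_ ?_
    · rw [hxm, foldComb_S2 _ hm3 hmK]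
      omega
    · rintro ⟨y, hyS⟩ hy hyx
      rcases (Set.mem_union _ _ _).mp hyS with hyS' | hyS'
      · right
        obtain ⟨n, h1, h2, rfl⟩ := mem_S1set_four_mul.mp hyS'
        rw [foldComb_S1 _ h1 h2]
        omega
      · obtain ⟨m', rfl | hm', rfl⟩ := mem_S2set_four_mul.mp hyS'
        · exact Or.inl (hone _ hy (by norm_num))
        · right
          have hne : m' ≠ m := by
            rintro rfl
            exact hyx (Subtype.ext hxm.symm)
          rw [foldComb_S2 _ hm'.1 hm'.2]
          omega
  rintro ⟨x, hxS⟩ hx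
  rcases (Set.mem_union _ _ _).mp hxS with hxS' | hxS'
  · obtain ⟨n, h1, h2, rfl⟩ := mem_S1set_four_mul.mp hxS'
    refine hisolate (fun a => if a ≤ n then 1 else 0) _ hx ?_ ?_
    · rw [foldComb_S1 _ h1 h2]
      simp (disch := omega) only [if_pos, if_neg]
      norm_num
    · rintro ⟨y, hyS⟩ hy hyx
      rcases (Set.mem_union _ _ _).mp hyS with hyS' | hyS'
      · right
        obtain ⟨n', h1', h2', rfl⟩ := mem_S1set_four_mul.mp hyS'
        have hne : n' ≠ n := by
          rintro rfl
          exact hyx rfl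
        rw [foldComb_S1 _ h1' h2']
        rcases lt_or_gt_of_ne hne with h | h <;>
          simp (disch := omega) only [if_pos, if_neg] <;> norm_num
      · left
        obtain ⟨m, rfl | hm, rfl⟩ := mem_S2set_four_mul.mp hyS'
        · exact hone _ hy (by norm_num)
        · exact htwo _ hy m hm.1 hm.2 rfl
  · obtain ⟨m, rfl | hm, rfl⟩ := mem_S2set_four_mul.mp hxS'
    · exact hone _ hx (by norm_num)
    · exact htwo _ hx m hm.1 hm.2 rfl

theorem S1set_union_S2set_eq_image (K : ℕ) :
    S1set (4 * K) ∪ S2set (4 * K) =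
      ((Finset.Icc (1 : ℤ) (K - 1)).image
          (fun n => ((0 : ℤ), n + 1, 2 * (K : ℤ) - n, 2 * (K : ℤ) - 1)) ∪
        (insert 1 (Finset.Icc (3 : ℤ) (K + 1))).image
          (fun m => (2 - m, m, 2 * (K : ℤ) - 1, 2 * (K : ℤ) - 1)) : Finset (ℤ × ℤ × ℤ × ℤ)) := by
  ext x
  simp only [Set.mem_union, mem_S1set_four_mul, mem_S2set_four_mul, Finset.coe_union,
    Finset.coe_image, Set.mem_image, Finset.mem_coe, Finset.mem_Icc, Finset.mem_insert,
    and_assoc, eq_comm (a := x)]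

theorem ncard_S1set_union_S2set {K : ℕ} (hK : 2 ≤ K) :
    (S1set (4 * K) ∪ S2set (4 * K)).ncard = 2 * K - 1 := by
  rw [S1set_union_S2set_eq_image, Set.ncard_coe_finset, Finset.card_union_of_disjoint,
    Finset.card_image_of_injective, Finset.card_image_of_injective, Finset.card_insert_of_notMem,
    Int.card_Icc, Int.card_Icc]
  · omega
  · simp
  · intro a b h
    exact (Prod.mk.inj (Prod.mk.inj h).2).1
  · intro a b h
    have := (Prod.mk.inj (Prod.mk.inj h).2).1
    omega
  · rw [Finset.disjoint_left]
    intro x h1 h2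
    simp only [Finset.mem_image, Finset.mem_Icc, Finset.mem_insert] at h1 h2
    obtain ⟨n, hn, rfl⟩ := h1
    obtain ⟨m, hm, h⟩ := h2
    simp only [Prod.mk.injEq] at h
    omega

theorem finrank_iInf_ker_add_ncard {V ι : Type*} [AddCommGroup V] [Module ℝ V]
    [FiniteDimensional ℝ V] (S : Set ι) (hS : S.Finite) (φ : ι → Module.Dual ℝ V)
    (hφ : LinearIndependent ℝ (fun x : S => φ x)) :
    S.ncard + Module.finrank ℝ ↥(⨅ x ∈ S, LinearMap.ker (φ x)) = Module.finrank ℝ V := by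
  have : Fintype S := hS.fintype
  have hker : (⨅ x ∈ S, LinearMap.ker (φ x)) =
      (Submodule.span ℝ (Set.range fun x : S => φ x)).dualCoannihilator := by
    apply SetLike.coe_injective
    rw [Submodule.coe_dualCoannihilator_span]
    ext v
    simp
  rw [hker, ← Subspace.finrank_add_finrank_dualCoannihilator_eq
    (Submodule.span ℝ (Set.range fun x : S => φ x)), finrank_span_eq_card hφ,
    Set.ncard_eq_toFinset_card', Set.toFinset_card]

theorem psi_S1_union_S2_linearIndependent (N : ℕ) (hN4 : 4 ∣ N) (hN8 : 8 ≤ N) :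
    (S1set N ∪ S2set N).ncard = N / 2 - 1 ∧
    LinearIndependent ℝ (fun x : ↥(S1set N ∪ S2set N) =>
      psiLin N x.1.1 x.1.2.1 x.1.2.2.1 x.1.2.2.2) ∧
    Module.finrank ℝ
      ↥(⨅ x ∈ S1set N ∪ S2set N, LinearMap.ker (psiLin N x.1 x.2.1 x.2.2.1 x.2.2.2)) = 1 ∧
    ∃ b : Fin (N / 2) → ℝ, b ≠ 0 ∧
      ∀ x ∈ S1set N ∪ S2set N, psi N b x.1 x.2.1 x.2.2.1 x.2.2.2 = 0 := by
  obtain ⟨K, rfl⟩ := hN4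
  have hK : 2 ≤ K := by omega
  have hcard := ncard_S1set_union_S2set hK
  have hli := linearIndependent_psiLin hK
  have hfin : (S1set (4 * K) ∪ S2set (4 * K)).Finite := by
    rw [S1set_union_S2set_eq_image]
    exact Finset.finite_toSet _
  have hrank := finrank_iInf_ker_add_ncard (S1set (4 * K) ∪ S2set (4 * K)) hfin
    (fun x => psiLin (4 * K) x.1 x.2.1 x.2.2.1 x.2.2.2) hli
  rw [hcard, Module.finrank_fin_fun] at hrank
  have hone : Module.finrank ℝ ↥(⨅ x ∈ S1set (4 * K) ∪ S2set (4 * K),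
      LinearMap.ker (psiLin (4 * K) x.1 x.2.1 x.2.2.1 x.2.2.2)) = 1 := by omega
  refine ⟨by omega, hli, hone, ?_⟩
  obtain ⟨⟨b, hb⟩, hb0, -⟩ := finrank_eq_one_iff'.mp hone
  refine ⟨b, fun h => hb0 (Subtype.ext h), fun x hx => ?_⟩
  rw [← psiLin_apply]
  simp only [Submodule.mem_iInf, LinearMap.mem_ker] at hb
  exact hb x hx
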